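/- arXiv:2605.26698 — 2 statements merged into one kernel-verified Lean document; each statement's English description precedes it below -/
import Mathlib

section
/- Soundness of delay simulation: let A1 = (S1, step1, F1) and A2 = (S2, step2, F2) be Büchi automata over the same event type E. If fsimL_delay s1 s2 holds, then L_{A1}(s1) ⊆ L_{A2}(s2). -/
namespace AFS

/-- Greatest fixed point (Knaster–Tarski): for a monotone `f`, this is the
greatest fixed point of `f`. -/
def gfp {α : Type*} [CompleteLattice α] (f : α → α) : α := sSup {a | a ≤ f a}

/-- Least fixed point (Knaster–Tarski): for a monotone `f`, this is the
least fixed point of `f`. -/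
def lfp {α : Type*} [CompleteLattice α] (f : α → α) : α := sInf {a | f a ≤ a}

variable {E S S1 S2 : Type*}

/-- `ρ` is a run of the transition relation `step` from state `s` over the infinite word `τ`. -/
def IsRun (step : S → E → S → Prop) (s : S) (τ : ℕ → E) (ρ : ℕ → S) : Prop :=
  ρ 0 = s ∧ ∀ n, step (ρ n) (τ n) (ρ (n + 1))

/-- Büchi language of a state: words admitting a run visiting `F` infinitely often. -/
def Lang (step : S → E → S → Prop) (F : Set S) (s : S) : Set (ℕ → E) :=
  {τ | ∃ ρ, IsRun step s τ ρ ∧ {n | ρ n ∈ F}.Infinite}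

/-- Traces of a state: words admitting a run (no acceptance requirement). -/
def Traces (step : S → E → S → Prop) (s : S) : Set (ℕ → E) :=
  {τ | ∃ ρ, IsRun step s τ ρ}

/-- One-step matching operator on relations. -/
def Match (step1 : S1 → E → S1 → Prop) (step2 : S2 → E → S2 → Prop)
    (X : S1 → S2 → Prop) : S1 → S2 → Prop :=
  fun s1 s2 => ∀ e s1', step1 s1 e s1' → ∃ s2', step2 s2 e s2' ∧ X s1' s2'

/-- Inductive part of delay simulation: reach a right-accepting state, then pass to `X`. -/
def fsimRdelay (step1 : S1 → E → S1 → Prop) (step2 : S2 → E → S2 → Prop)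
    (F2 : Set S2) (X : S1 → S2 → Prop) : S1 → S2 → Prop :=
  lfp (fun Y =>
    (fun s1 s2 => s2 ∈ F2 ∧ Match step1 step2 X s1 s2) ⊔ Match step1 step2 Y)

/-- Functor underlying delay simulation. -/
def fsimLdelayF (step1 : S1 → E → S1 → Prop) (F1 : Set S1)
    (step2 : S2 → E → S2 → Prop) (F2 : Set S2)
    (X : S1 → S2 → Prop) : S1 → S2 → Prop :=
  fsimRdelay step1 step2 F2 X ⊔ (fun s1 s2 => s1 ∉ F1 ∧ Match step1 step2 X s1 s2)

/-- Delay simulation. -/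
def fsimLdelay (step1 : S1 → E → S1 → Prop) (F1 : Set S1)
    (step2 : S2 → E → S2 → Prop) (F2 : Set S2) : S1 → S2 → Prop :=
  gfp (fsimLdelayF step1 F1 step2 F2)

/-- From position `n` and state `t`, after `k` steps along `τ` one can reach a state of `F`
from which one further step leads into the family of state predicates `X`. -/
def ReachesIn (step : S → E → S → Prop) (F : Set S) (τ : ℕ → E) (X : ℕ → S → Prop) :
    ℕ → ℕ → S → Prop
  | 0, n, t => t ∈ F ∧ ∃ t', step t (τ n) t' ∧ X (n + 1) t'
  | k + 1, n, t => ∃ t', step t (τ n) t' ∧ ReachesIn step F τ X k (n + 1) t'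

/-- If `X` can always reach `F` and then return to `X`, then there is an accepting run. -/
theorem mem_lang_of_reachesIn {step : S → E → S → Prop} {F : Set S} {τ : ℕ → E}
    {X : ℕ → S → Prop} (hX : ∀ n t, X n t → ∃ k, ReachesIn step F τ X k n t)
    {s : S} (hs : X 0 s) : τ ∈ Lang step F s := by
  have next : ∀ n t k, ReachesIn step F τ X k n t → ∃ t' k', step t (τ n) t' ∧
      ReachesIn step F τ X k' (n + 1) t' ∧ (t ∈ F ∨ k' < k) := by
    rintro n t (_ | k) h
    · obtain ⟨hF, t', ht, hx⟩ := h
      obtain ⟨k', hk'⟩ := hX _ _ hx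
      exact ⟨t', k', ht, hk', .inl hF⟩
    · obtain ⟨t', ht, hk⟩ := h
      exact ⟨t', k, ht, hk, .inr k.lt_succ_self⟩
  choose f g hstep hreach hdec using next
  obtain ⟨k₀, h₀⟩ := hX 0 s hs
  let u : ∀ n, {p : S × ℕ // ReachesIn step F τ X p.2 n p.1} := fun n =>
    Nat.rec ⟨(s, k₀), h₀⟩ (fun n p => ⟨(f n p.1.1 p.1.2 p.2, g n p.1.1 p.1.2 p.2),
      hreach n p.1.1 p.1.2 p.2⟩) n
  refine ⟨fun n => (u n).1.1, ⟨rfl, fun n => hstep n _ _ (u n).2⟩, ?_⟩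
  have hu : ∀ k n, (u n).1.2 = k → ∃ m, n ≤ m ∧ (u m).1.1 ∈ F := by
    intro k
    induction k using Nat.strong_induction_on with
    | _ k ih =>
      intro n hn
      rcases hdec n _ _ (u n).2 with h | h
      · exact ⟨n, le_rfl, h⟩
      · obtain ⟨m, hm, hF⟩ := ih _ (hn ▸ h) (n + 1) rfl
        exact ⟨m, by omega, hF⟩
  refine Set.infinite_of_forall_exists_gt fun n => ?_
  obtain ⟨m, hm, hF⟩ := hu _ (n + 1) rfl
  exact ⟨m, hF, hm⟩

theorem Match.mono {step1 : S1 → E → S1 → Prop} {step2 : S2 → E → S2 → Prop}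
    {X Y : S1 → S2 → Prop} (h : X ≤ Y) : Match step1 step2 X ≤ Match step1 step2 Y :=
  fun _ _ hX e s1' hs => let ⟨s2', ht, hx⟩ := hX e s1' hs; ⟨s2', ht, h _ _ hx⟩

theorem fsimRdelay_le {step1 : S1 → E → S1 → Prop} {step2 : S2 → E → S2 → Prop}
    {F2 : Set S2} {X Y : S1 → S2 → Prop}
    (hacc : (fun s1 s2 => s2 ∈ F2 ∧ Match step1 step2 X s1 s2) ≤ Y)
    (hstep : Match step1 step2 Y ≤ Y) : fsimRdelay step1 step2 F2 X ≤ Y :=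
  sInf_le (sup_le hacc hstep)

theorem fsimRdelay_mono {step1 : S1 → E → S1 → Prop} {step2 : S2 → E → S2 → Prop}
    {F2 : Set S2} {X Y : S1 → S2 → Prop} (h : X ≤ Y) :
    fsimRdelay step1 step2 F2 X ≤ fsimRdelay step1 step2 F2 Y :=
  le_sInf fun _ hZ => fsimRdelay_le
    (fun _ _ hs => hZ _ _ (.inl ⟨hs.1, Match.mono h _ _ hs.2⟩)) (le_sup_right.trans hZ)

theorem fsimLdelayF_mono {step1 : S1 → E → S1 → Prop} {F1 : Set S1}
    {step2 : S2 → E → S2 → Prop} {F2 : Set S2} {X Y : S1 → S2 → Prop} (h : X ≤ Y) :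
    fsimLdelayF step1 F1 step2 F2 X ≤ fsimLdelayF step1 F1 step2 F2 Y :=
  sup_le_sup (fsimRdelay_mono h) fun _ _ hs => ⟨hs.1, Match.mono h _ _ hs.2⟩

theorem fsimLdelay_le (step1 : S1 → E → S1 → Prop) (F1 : Set S1)
    (step2 : S2 → E → S2 → Prop) (F2 : Set S2) :
    fsimLdelay step1 F1 step2 F2 ≤
      fsimLdelayF step1 F1 step2 F2 (fsimLdelay step1 F1 step2 F2) :=
  sSup_le fun _ hX => le_trans hX (fsimLdelayF_mono (le_sSup hX))

theorem exists_reachesIn_of_fsimRdelay {step1 : S1 → E → S1 → Prop}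
    {step2 : S2 → E → S2 → Prop} {F2 : Set S2} {X : S1 → S2 → Prop} {τ : ℕ → E} {ρ : ℕ → S1}
    (hρ : ∀ n, step1 (ρ n) (τ n) (ρ (n + 1))) {n : ℕ} {t : S2}
    (h : fsimRdelay step1 step2 F2 X (ρ n) t) :
    ∃ k, ReachesIn step2 F2 τ (fun n => X (ρ n)) k n t := by
  refine fsimRdelay_le
    (Y := fun s t => ∀ n, ρ n = s → ∃ k, ReachesIn step2 F2 τ (fun n => X (ρ n)) k n t)
    ?_ ?_ _ _ h n rfl
  · rintro _ t ⟨hF, hM⟩ n rfl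
    exact ⟨0, hF, hM _ _ (hρ n)⟩
  · rintro _ t hM n rfl
    obtain ⟨t', ht, hY⟩ := hM _ _ (hρ n)
    obtain ⟨k, hk⟩ := hY _ rfl
    exact ⟨k + 1, t', ht, hk⟩

theorem exists_reachesIn_of_fsimLdelay {step1 : S1 → E → S1 → Prop} {F1 : Set S1}
    {step2 : S2 → E → S2 → Prop} {F2 : Set S2} {τ : ℕ → E} {ρ : ℕ → S1}
    (hρ : ∀ n, step1 (ρ n) (τ n) (ρ (n + 1))) {n d : ℕ} (hF : ρ (n + d) ∈ F1) {t : S2}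
    (h : fsimLdelay step1 F1 step2 F2 (ρ n) t) :
    ∃ k, ReachesIn step2 F2 τ (fun n => fsimLdelay step1 F1 step2 F2 (ρ n)) k n t := by
  induction d generalizing n t with
  | zero =>
    rcases fsimLdelay_le step1 F1 step2 F2 _ _ h with hR | ⟨hn, -⟩
    · exact exists_reachesIn_of_fsimRdelay hρ hR
    · exact absurd hF hn
  | succ d ih =>
    rcases fsimLdelay_le step1 F1 step2 F2 _ _ h with hR | ⟨-, hM⟩
    · exact exists_reachesIn_of_fsimRdelay hρ hR
    · obtain ⟨t', ht, hL⟩ := hM _ _ (hρ n)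
      obtain ⟨k, hk⟩ := ih (by rwa [Nat.add_right_comm]) hL
      exact ⟨k + 1, t', ht, hk⟩

/-- Soundness of delay simulation for language inclusion of Büchi automata. -/
theorem stmt8 (step1 : S1 → E → S1 → Prop) (F1 : Set S1)
    (step2 : S2 → E → S2 → Prop) (F2 : Set S2)
    (s1 : S1) (s2 : S2) (h : fsimLdelay step1 F1 step2 F2 s1 s2) :
    Lang step1 F1 s1 ⊆ Lang step2 F2 s2 := by
  rintro τ ⟨ρ, ⟨rfl, hρ⟩, hinf⟩
  refine mem_lang_of_reachesIn (X := fun n => fsimLdelay step1 F1 step2 F2 (ρ n)) ?_ h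
  intro n t hnt
  obtain ⟨m, hm, hnm⟩ := hinf.exists_gt n
  obtain ⟨d, rfl⟩ := Nat.exists_eq_add_of_le hnm.le
  exact exists_reachesIn_of_fsimLdelay hρ hm hnt

end AFS
end

section
/- Soundness of repeated delay simulation: let A1 = (S1, step1, F1) and A2 = (S2, step2, F2) be Büchi automata over the same event type E. Define fsimW(X) := lfp (fun Y => Match(Y) ⊔ X), fsimR(X) := lfp (fun Y => (fun s1 s2 => s2 ∈ F2 ∧ Match(fsimW(X)) s1 s2) ⊔ Match(Y)), fsimL := gfp (fun X => fsimR(X) ⊔ (fun s1 s2 => s1 ∉ F1 ∧ Match(X) s1 s2)), and fsim_rdelay := fsimW(fsimL). If fsim_rdelay s1 s2 holds, then L_{A1}(s1) ⊆ L_{A2}(s2). -/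
namespace AFS

variable {E S S1 S2 : Type*}

/-- `fsimW`: wait for finitely many steps, then pass to `X` (alias of `delay`). -/
def fsimW (step1 : S1 → E → S1 → Prop) (step2 : S2 → E → S2 → Prop)
    (X : S1 → S2 → Prop) : S1 → S2 → Prop :=
  lfp (fun Y => Match step1 step2 Y ⊔ X)

/-- Inductive part of repeated delay simulation: reach a right-accepting state,
then pass to `fsimW X`. -/
def fsimRr (step1 : S1 → E → S1 → Prop) (step2 : S2 → E → S2 → Prop)
    (F2 : Set S2) (X : S1 → S2 → Prop) : S1 → S2 → Prop :=
  lfp (fun Y =>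
    (fun s1 s2 => s2 ∈ F2 ∧ Match step1 step2 (fsimW step1 step2 X) s1 s2) ⊔
      Match step1 step2 Y)

/-- Coinductive part of repeated delay simulation. -/
def fsimLr (step1 : S1 → E → S1 → Prop) (F1 : Set S1)
    (step2 : S2 → E → S2 → Prop) (F2 : Set S2) : S1 → S2 → Prop :=
  gfp (fun X => fsimRr step1 step2 F2 X ⊔
    (fun s1 s2 => s1 ∉ F1 ∧ Match step1 step2 X s1 s2))

/-- Repeated delay simulation. -/
def fsimRdelaySim (step1 : S1 → E → S1 → Prop) (F1 : Set S1)
    (step2 : S2 → E → S2 → Prop) (F2 : Set S2) : S1 → S2 → Prop :=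
  fsimW step1 step2 (fsimLr step1 F1 step2 F2)

theorem lfp_le {α : Type*} [CompleteLattice α] {f : α → α} {a : α} (h : f a ≤ a) : lfp f ≤ a :=
  sInf_le h

theorem lfp_mono {α : Type*} [CompleteLattice α] {f g : α → α} (h : f ≤ g) : lfp f ≤ lfp g :=
  le_sInf fun a ha => sInf_le ((h a).trans ha)

theorem gfp_le_apply {α : Type*} [CompleteLattice α] {f : α → α} (hf : Monotone f) :
    gfp f ≤ f (gfp f) :=
  sSup_le fun _ ha => le_trans ha (hf (le_sSup ha))

theorem match_mono (step1 : S1 → E → S1 → Prop) (step2 : S2 → E → S2 → Prop) :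
    Monotone (Match step1 step2) := by
  intro X Y hXY s1 s2 h e s1' hs
  obtain ⟨s2', h2, hX⟩ := h e s1' hs
  exact ⟨s2', h2, hXY _ _ hX⟩

theorem fsimW_mono (step1 : S1 → E → S1 → Prop) (step2 : S2 → E → S2 → Prop) :
    Monotone (fsimW step1 step2) :=
  fun _ _ hXY => lfp_mono fun _ => sup_le_sup_left hXY _

theorem fsimRr_mono (step1 : S1 → E → S1 → Prop) (step2 : S2 → E → S2 → Prop) (F2 : Set S2) :
    Monotone (fsimRr step1 step2 F2) := fun _ _ hXY =>
  lfp_mono fun _ => sup_le_sup_right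
    (fun s1 s2 h => ⟨h.1, match_mono step1 step2 (fsimW_mono step1 step2 hXY) s1 s2 h.2⟩) _

theorem fsimLr_unfold {step1 : S1 → E → S1 → Prop} {F1 : Set S1}
    {step2 : S2 → E → S2 → Prop} {F2 : Set S2} {s1 : S1} {s2 : S2}
    (h : fsimLr step1 F1 step2 F2 s1 s2) :
    fsimRr step1 step2 F2 (fsimLr step1 F1 step2 F2) s1 s2 ∨
      (s1 ∉ F1 ∧ Match step1 step2 (fsimLr step1 F1 step2 F2) s1 s2) := by
  have hmono : Monotone (fun X => fsimRr step1 step2 F2 X ⊔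
      (fun s1 s2 => s1 ∉ F1 ∧ Match step1 step2 X s1 s2)) := fun X Y hXY =>
    sup_le_sup (fsimRr_mono step1 step2 F2 hXY)
      fun a b hab => ⟨hab.1, match_mono step1 step2 hXY a b hab.2⟩
  exact gfp_le_apply hmono s1 s2 h

/-- `AcceptsIn step F τ G k n s`: reading `τ` from position `n`, the state `s` can reach in `k`
steps a state of `F` which has a further step to a state satisfying `G` at its position. -/
def AcceptsIn (step : S → E → S → Prop) (F : Set S) (τ : ℕ → E) (G : ℕ → S → Prop) :
    ℕ → ℕ → S → Prop
  | 0, n, s => s ∈ F ∧ ∃ s', step s (τ n) s' ∧ G (n + 1) s'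
  | k + 1, n, s => ∃ s', step s (τ n) s' ∧ AcceptsIn step F τ G k (n + 1) s'

/-- If every state satisfying `G` can reach an accepting state and then return to `G`, then the
word is accepted from every state satisfying `G` at position `0`. -/
theorem mem_lang_of_acceptsIn {step : S → E → S → Prop} {F : Set S} {τ : ℕ → E}
    {G : ℕ → S → Prop} (hG : ∀ n s, G n s → ∃ k, AcceptsIn step F τ G k n s)
    {s : S} (hs : G 0 s) : τ ∈ Lang step F s := by
  obtain ⟨k₀, hk₀⟩ := hG 0 s hs
  have hnext : ∀ n (p : {p : ℕ × S // AcceptsIn step F τ G p.1 n p.2}),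
      ∃ q : {q : ℕ × S // AcceptsIn step F τ G q.1 (n + 1) q.2},
        step p.1.2 (τ n) q.1.2 ∧ ∀ k, p.1.1 = k + 1 → q.1.1 = k := by
    rintro n ⟨⟨_ | k, t⟩, ht⟩
    · obtain ⟨-, t', hstep, ht'⟩ := ht
      obtain ⟨k, hk⟩ := hG _ _ ht'
      exact ⟨⟨(k, t'), hk⟩, hstep, fun j hj => by simp at hj⟩
    · obtain ⟨t', hstep, ht'⟩ := ht
      exact ⟨⟨(k, t'), ht'⟩, hstep, fun j hj => by simpa using hj⟩
  choose next hstep hrank using hnext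
  let r : (n : ℕ) → {p : ℕ × S // AcceptsIn step F τ G p.1 n p.2} :=
    fun n => Nat.rec ⟨(k₀, s), hk₀⟩ next n
  have hreach : ∀ k n, (r n).1.1 = k → (r (n + k)).1.2 ∈ F := by
    intro k
    induction k with
    | zero =>
      intro n hn
      have h := (r n).2
      rw [hn] at h
      exact h.1
    | succ k ih =>
      intro n hn
      have h := ih (n + 1) (hrank n (r n) k hn)
      rwa [Nat.add_right_comm] at h
  refine ⟨fun n => (r n).1.2, ⟨rfl, fun n => hstep n (r n)⟩, ?_⟩
  exact Nat.frequently_atTop_iff_infinite.1 <| Filter.frequently_atTop.2 fun n =>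
    ⟨n + (r n).1.1, Nat.le_add_right _ _, hreach _ n rfl⟩

section AlongRun

variable {step1 : S1 → E → S1 → Prop} {step2 : S2 → E → S2 → Prop} {F2 : Set S2}
  {τ : ℕ → E} {ρ : ℕ → S1} {X : S1 → S2 → Prop} {G : ℕ → S2 → Prop}

theorem exists_acceptsIn_of_match (hρ : ∀ n, step1 (ρ n) (τ n) (ρ (n + 1)))
    {n : ℕ} {t : S2} (h : Match step1 step2 X (ρ n) t)
    (hX : ∀ t', X (ρ (n + 1)) t' → ∃ k, AcceptsIn step2 F2 τ G k (n + 1) t') :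
    ∃ k, AcceptsIn step2 F2 τ G k n t := by
  obtain ⟨t', hstep, ht'⟩ := h _ _ (hρ n)
  obtain ⟨k, hk⟩ := hX t' ht'
  exact ⟨k + 1, t', hstep, hk⟩

theorem exists_acceptsIn_of_fsimW (hρ : ∀ n, step1 (ρ n) (τ n) (ρ (n + 1)))
    (hX : ∀ n t, X (ρ n) t → ∃ k, AcceptsIn step2 F2 τ G k n t)
    {n : ℕ} {t : S2} (h : fsimW step1 step2 X (ρ n) t) :
    ∃ k, AcceptsIn step2 F2 τ G k n t := by
  have hle : fsimW step1 step2 X ≤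
      fun s t => ∀ n, ρ n = s → ∃ k, AcceptsIn step2 F2 τ G k n t := by
    refine lfp_le ?_
    rintro _ t (h | h) n rfl
    · exact exists_acceptsIn_of_match hρ h fun t' ht' => ht' _ rfl
    · exact hX n t h
  exact hle _ _ h n rfl

theorem exists_acceptsIn_of_fsimRr (hρ : ∀ n, step1 (ρ n) (τ n) (ρ (n + 1)))
    {n : ℕ} {t : S2} (h : fsimRr step1 step2 F2 X (ρ n) t) :
    ∃ k, AcceptsIn step2 F2 τ (fun n t => fsimW step1 step2 X (ρ n) t) k n t := by
  have hle : fsimRr step1 step2 F2 X ≤ fun s t => ∀ n, ρ n = s →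
      ∃ k, AcceptsIn step2 F2 τ (fun n t => fsimW step1 step2 X (ρ n) t) k n t := by
    refine lfp_le ?_
    rintro _ t (h | h) n rfl
    · exact ⟨0, h.1, h.2 _ _ (hρ n)⟩
    · exact exists_acceptsIn_of_match hρ h fun t' ht' => ht' _ rfl
  exact hle _ _ h n rfl

theorem exists_acceptsIn_of_fsimLr {F1 : Set S1} (hρ : ∀ n, step1 (ρ n) (τ n) (ρ (n + 1)))
    (hF : {n | ρ n ∈ F1}.Infinite) (n : ℕ) (t : S2)
    (h : fsimLr step1 F1 step2 F2 (ρ n) t) :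
    ∃ k, AcceptsIn step2 F2 τ
      (fun n t => fsimRdelaySim step1 F1 step2 F2 (ρ n) t) k n t := by
  obtain ⟨m, hm, hnm⟩ := hF.exists_gt n
  obtain ⟨d, rfl⟩ := Nat.exists_eq_add_of_le hnm.le
  clear hnm
  induction d generalizing n t with
  | zero =>
    rcases fsimLr_unfold h with h | h
    · exact exists_acceptsIn_of_fsimRr hρ h
    · exact absurd hm h.1
  | succ d ih =>
    rcases fsimLr_unfold h with h | h
    · exact exists_acceptsIn_of_fsimRr hρ h
    · refine exists_acceptsIn_of_match hρ h.2 fun t' ht' => ih (n + 1) t' ht' ?_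
      rwa [Nat.add_right_comm]

end AlongRun

/-- Soundness of repeated delay simulation for language inclusion. -/
theorem stmt16 (step1 : S1 → E → S1 → Prop) (F1 : Set S1)
    (step2 : S2 → E → S2 → Prop) (F2 : Set S2)
    (s1 : S1) (s2 : S2) (h : fsimRdelaySim step1 F1 step2 F2 s1 s2) :
    Lang step1 F1 s1 ⊆ Lang step2 F2 s2 := by
  rintro τ ⟨ρ, ⟨rfl, hρ⟩, hF⟩
  exact mem_lang_of_acceptsIn
    (G := fun n t => fsimRdelaySim step1 F1 step2 F2 (ρ n) t)
    (fun n t ht => exists_acceptsIn_of_fsimW hρ (exists_acceptsIn_of_fsimLr hρ hF) ht) h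

end AFS
end
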